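/- Let M be the distribution over Σ^T generated by a time-varying ISAN of sequence length T with hidden dimension d, and assume every sequence has positive probability. Then for every t ∈ {0,1,…,T−1}, the extended logit matrix L_M(Σ^t, Σ^{≤T−t}) has rank at most d. -/

import Mathlib

/-- The softmax distribution on a finite type associated to a vector `v`. -/
noncomputable def softmaxF {S : Type*} [Fintype S] (v : S → ℝ) (z : S) : ℝ :=
  Real.exp (v z) / ∑ z', Real.exp (v z')

/-- Hidden states of a time-varying ISAN along the token sequence `z`. -/
noncomputable def tvState {S : Type*} {d : ℕ}
    (A : S → ℕ → Matrix (Fin d) (Fin d) ℝ) (x0 : Fin d → ℝ) (z : ℕ → S) :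
    ℕ → Fin d → ℝ
  | 0 => x0
  | t + 1 => (A (z t) t).mulVec (tvState A x0 z t)

/-- Probability that a time-varying ISAN of sequence length `T` generates the tokens
`z 0, …, z (T-1)`. -/
noncomputable def tvProb {S : Type*} [Fintype S] {d : ℕ} (T : ℕ)
    (A : S → ℕ → Matrix (Fin d) (Fin d) ℝ) (B : ℕ → Matrix S (Fin d) ℝ)
    (x0 : Fin d → ℝ) (z : ℕ → S) : ℝ :=
  ∏ t ∈ Finset.range T, softmaxF ((B t).mulVec (tvState A x0 z t)) (z t)

/-- Extend a finite sequence to `ℕ → S` (junk beyond `T`). -/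
noncomputable def extSeq {S : Type*} [Nonempty S] {T : ℕ} (z : Fin T → S) : ℕ → S :=
  fun k => if h : k < T then z ⟨k, h⟩ else Classical.arbitrary S

/-- Probability under the language model `M` (a distribution on `Σ^T`) that the generated
sequence has the list `y` as a prefix. -/
noncomputable def prefProb {S : Type*} [Fintype S] [DecidableEq S] {T : ℕ}
    (M : (Fin T → S) → ℝ) (y : List S) : ℝ :=
  ∑ z ∈ Finset.univ.filter (fun z : Fin T → S => (List.ofFn z).take y.length = y), M z

/-- Conditional probability `Pr_M[z ∣ y]` that the next token after the prefix `y` is `z`. -/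
noncomputable def condProb {S : Type*} [Fintype S] [DecidableEq S] {T : ℕ}
    (M : (Fin T → S) → ℝ) (y : List S) (z : S) : ℝ :=
  prefProb M (y ++ [z]) / prefProb M y

/-- Mean-centered logits `L_M[z ∣ y]`. -/
noncomputable def mcLogit {S : Type*} [Fintype S] [DecidableEq S] {T : ℕ}
    (M : (Fin T → S) → ℝ) (y : List S) (z : S) : ℝ :=
  Real.log (condProb M y z)
    - (1 / (Fintype.card S : ℝ)) * ∑ z', Real.log (condProb M y z')

/-- Extended logit matrix `L_M(H, F)`: rows indexed by histories, columns by
(future, token) pairs, with entry `L_M[z ∣ h ∘ f]`. -/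
noncomputable def logitMatrix {S : Type*} [Fintype S] [DecidableEq S] {T : ℕ}
    (M : (Fin T → S) → ℝ) {H F : Type*} (hist : H → List S) (fut : F → List S) :
    Matrix H (F × S) ℝ :=
  Matrix.of fun h p => mcLogit M (hist h ++ fut p.1) p.2


/-- The sequence extending a list by an arbitrary token. -/
noncomputable def listSeq {S : Type*} [Nonempty S] (y : List S) : ℕ → S :=
  fun k => y.getD k (Classical.arbitrary S)

lemma listSeq_append_left {S : Type*} [Nonempty S] (y f : List S) {k : ℕ} (hk : k < y.length) :
    listSeq (y ++ f) k = listSeq y k :=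
  List.getD_append _ _ _ _ hk

lemma listSeq_append_right {S : Type*} [Nonempty S] (y f : List S) (i : ℕ) :
    listSeq (y ++ f) (y.length + i) = listSeq f i := by
  simp only [listSeq]
  rw [List.getD_append_right _ _ _ _ (Nat.le_add_right _ _), Nat.add_sub_cancel_left]

/-- Product of the `j` transition matrices along `w`, starting at time `t`. -/
noncomputable def transitionMatrix {S : Type*} {d : ℕ}
    (A : S → ℕ → Matrix (Fin d) (Fin d) ℝ) (w : ℕ → S) (t : ℕ) : ℕ → Matrix (Fin d) (Fin d) ℝ
  | 0 => 1
  | j + 1 => A (w j) (t + j) * transitionMatrix A w t j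

section Softmax

variable {S : Type*} [Fintype S] [Nonempty S]

lemma sum_exp_pos (v : S → ℝ) : 0 < ∑ z, Real.exp (v z) :=
  Finset.sum_pos (fun _ _ => Real.exp_pos _) Finset.univ_nonempty

lemma softmaxF_pos (v : S → ℝ) (z : S) : 0 < softmaxF v z :=
  div_pos (Real.exp_pos _) (sum_exp_pos v)

lemma sum_softmaxF (v : S → ℝ) : ∑ z, softmaxF v z = 1 := by
  simp only [softmaxF, ← Finset.sum_div]
  exact div_self (sum_exp_pos v).ne'

lemma log_softmaxF (v : S → ℝ) (z : S) :
    Real.log (softmaxF v z) = v z - Real.log (∑ z', Real.exp (v z')) := by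
  rw [softmaxF, Real.log_div (Real.exp_pos _).ne' (sum_exp_pos v).ne', Real.log_exp]

lemma log_softmaxF_sub_mean (v : S → ℝ) (z : S) :
    Real.log (softmaxF v z) - (1 / (Fintype.card S : ℝ)) * ∑ z', Real.log (softmaxF v z') =
      v z - (1 / (Fintype.card S : ℝ)) * ∑ z', v z' := by
  have hcard : (Fintype.card S : ℝ) ≠ 0 := by exact_mod_cast Fintype.card_ne_zero
  simp only [log_softmaxF, Finset.sum_sub_distrib, Finset.sum_const, Finset.card_univ,
    nsmul_eq_mul]
  field_simp
  ring

end Softmax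

section States

variable {S : Type*} {d : ℕ} (A : S → ℕ → Matrix (Fin d) (Fin d) ℝ) (x0 : Fin d → ℝ)

lemma tvState_congr {z w : ℕ → S} {n : ℕ} (h : ∀ k < n, z k = w k) :
    tvState A x0 z n = tvState A x0 w n := by
  induction n with
  | zero => rfl
  | succ n ih =>
    simp only [tvState]
    rw [h n n.lt_succ_self, ih fun k hk => h k (hk.trans n.lt_succ_self)]

lemma tvState_add {z w : ℕ → S} {t j : ℕ} (h : ∀ i < j, z (t + i) = w i) :
    tvState A x0 z (t + j) = (transitionMatrix A w t j).mulVec (tvState A x0 z t) := by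
  induction j with
  | zero => simp [transitionMatrix]
  | succ j ih =>
    rw [← add_assoc, tvState, transitionMatrix, ← Matrix.mulVec_mulVec,
      ih fun i hi => h i (hi.trans j.lt_succ_self), h j j.lt_succ_self]

variable [Fintype S] (B : ℕ → Matrix S (Fin d) ℝ)

lemma tvProb_congr {z w : ℕ → S} {n : ℕ} (h : ∀ k < n, z k = w k) :
    tvProb n A B x0 z = tvProb n A B x0 w := by
  refine Finset.prod_congr rfl fun k hk => ?_
  have hk := Finset.mem_range.mp hk
  rw [h k hk, tvState_congr A x0 fun i hi => h i (hi.trans hk)]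

variable [Nonempty S]

lemma tvProb_pos (n : ℕ) (z : ℕ → S) : 0 < tvProb n A B x0 z :=
  Finset.prod_pos fun _ _ => softmaxF_pos _ _

lemma tvProb_append_singleton (y : List S) (s : S) :
    tvProb (y.length + 1) A B x0 (listSeq (y ++ [s])) =
      tvProb y.length A B x0 (listSeq y) *
        softmaxF ((B y.length).mulVec (tvState A x0 (listSeq y) y.length)) s := by
  have hs : listSeq (y ++ [s]) y.length = s := by simp [listSeq]
  have hy : ∀ k < y.length, listSeq (y ++ [s]) k = listSeq y k := fun k hk =>
    listSeq_append_left y [s] hk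
  rw [← tvProb_congr A x0 B hy, ← tvState_congr A x0 hy, tvProb, Finset.prod_range_succ, hs,
    tvProb]

end States

section PrefixProbability

variable {S : Type*} [Fintype S] [DecidableEq S] {T : ℕ} (M : (Fin T → S) → ℝ)

lemma prefProb_eq_sum_append {y : List S} (hy : y.length < T) :
    prefProb M y = ∑ s, prefProb M (y ++ [s]) := by
  simp only [prefProb, Finset.sum_filter]
  rw [Finset.sum_comm]
  refine Finset.sum_congr rfl fun z _ => ?_
  have hlen : y.length < (List.ofFn z).length := by simpa using hy
  have key : ∀ s, (List.ofFn z).take (y ++ [s]).length = y ++ [s] ↔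
      (List.ofFn z).take y.length = y ∧ (List.ofFn z)[y.length] = s := by
    intro s
    rw [List.length_append, List.length_singleton, List.take_add_one,
      List.getElem?_eq_getElem hlen, Option.toList_some]
    constructor
    · intro h
      obtain ⟨h₁, h₂⟩ := List.append_inj' h rfl
      exact ⟨h₁, List.singleton_inj.mp h₂⟩
    · rintro ⟨h₁, h₂⟩
      rw [h₁, h₂]
  simp only [key, ite_and]
  split_ifs <;> simp

lemma prefProb_of_length_gt {y : List S} (hy : T < y.length) : prefProb M y = 0 := by
  refine Finset.sum_eq_zero fun z hz => ?_
  have h := congrArg List.length (Finset.mem_filter.mp hz).2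
  simp only [List.length_take, List.length_ofFn] at h
  omega

lemma mcLogit_of_length_ge {y : List S} (hy : T ≤ y.length) (s : S) : mcLogit M y s = 0 := by
  have h : ∀ s, condProb M y s = 0 := fun s => by
    rw [condProb, prefProb_of_length_gt M (by simpa using Nat.lt_succ_of_le hy), zero_div]
  simp [mcLogit, h]

lemma prefProb_of_length_eq [Nonempty S] {y : List S} (hy : y.length = T) :
    prefProb M y = M fun i => listSeq y i := by
  have h : Finset.univ.filter (fun z : Fin T → S => (List.ofFn z).take y.length = y) =
      {fun i : Fin T => listSeq y i} := by
    ext z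
    simp only [Finset.mem_filter, Finset.mem_univ, true_and, Finset.mem_singleton]
    rw [List.take_of_length_le (by simp [hy])]
    constructor
    · rintro rfl
      ext i
      simp [listSeq]
    · rintro rfl
      refine List.ext_getElem (by simp [hy]) fun i _ hi => ?_
      simp [listSeq, hi]
  rw [prefProb, h, Finset.sum_singleton]

variable [Nonempty S] {d : ℕ} {A : S → ℕ → Matrix (Fin d) (Fin d) ℝ}
  {B : ℕ → Matrix S (Fin d) ℝ} {x0 : Fin d → ℝ} {M}

lemma prefProb_eq_tvProb (hM : ∀ z : Fin T → S, M z = tvProb T A B x0 (extSeq z))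
    {y : List S} (hy : y.length ≤ T) :
    prefProb M y = tvProb y.length A B x0 (listSeq y) := by
  obtain ⟨n, hn⟩ := Nat.exists_eq_add_of_le hy
  induction n generalizing y with
  | zero =>
    rw [prefProb_of_length_eq M hn.symm, hM, ← (hn.symm : y.length = T)]
    refine tvProb_congr A x0 B fun k hk => ?_
    rw [extSeq, dif_pos hk]
  | succ n ih =>
    rw [prefProb_eq_sum_append M (by omega)]
    have h : ∀ s, prefProb M (y ++ [s]) = _ := fun s =>
      (ih (y := y ++ [s]) (by simp; omega) (by simp; omega)).trans
        (by rw [List.length_append, List.length_singleton, tvProb_append_singleton])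
    simp only [h, ← Finset.mul_sum, sum_softmaxF, mul_one]

lemma condProb_eq_softmaxF (hM : ∀ z : Fin T → S, M z = tvProb T A B x0 (extSeq z))
    {y : List S} (hy : y.length < T) (s : S) :
    condProb M y s =
      softmaxF ((B y.length).mulVec (tvState A x0 (listSeq y) y.length)) s := by
  rw [condProb, prefProb_eq_tvProb hM hy.le, prefProb_eq_tvProb hM (by simpa using hy),
    List.length_append, List.length_singleton, tvProb_append_singleton,
    mul_div_cancel_left₀ _ (tvProb_pos A x0 B _ _).ne']

lemma mcLogit_append (hM : ∀ z : Fin T → S, M z = tvProb T A B x0 (extSeq z))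
    {h f : List S} (hlen : h.length + f.length < T) (s : S) :
    mcLogit M (h ++ f) s = ∑ i, tvState A x0 (listSeq h) h.length i *
      ((B (h.length + f.length) * transitionMatrix A (listSeq f) h.length f.length) s i -
        (1 / (Fintype.card S : ℝ)) * ∑ s',
          (B (h.length + f.length) * transitionMatrix A (listSeq f) h.length f.length) s' i) := by
  have hlen' : (h ++ f).length < T := by simpa using hlen
  simp only [mcLogit, condProb_eq_softmaxF hM hlen', log_softmaxF_sub_mean]
  rw [List.length_append, tvState_add A x0 fun i _ => listSeq_append_right h f i,
    tvState_congr A x0 fun k hk => listSeq_append_left h f hk, Matrix.mulVec_mulVec]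
  simp only [Matrix.mulVec, dotProduct, mul_sub, Finset.sum_sub_distrib]
  congr 1
  · exact Finset.sum_congr rfl fun i _ => mul_comm _ _
  · rw [Finset.sum_comm, Finset.mul_sum]
    refine Finset.sum_congr rfl fun i _ => ?_
    rw [← Finset.sum_mul]
    ring

end PrefixProbability

/-- if `M` is the distribution on `Σ^T` generated by a time-varying ISAN
with hidden dimension `d`, and every sequence has positive probability, then for every
`t ∈ {0, …, T−1}` the extended logit matrix `L_M(Σ^t, Σ^{≤T−t})` has rank at most `d`. -/
theorem stmt_8 {S : Type*} [Fintype S] [DecidableEq S] [Nonempty S] (T d : ℕ)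
    (A : S → ℕ → Matrix (Fin d) (Fin d) ℝ) (B : ℕ → Matrix S (Fin d) ℝ)
    (x0 : Fin d → ℝ)
    (M : (Fin T → S) → ℝ) (hM : ∀ z : Fin T → S, M z = tvProb T A B x0 (extSeq z))
    (hpos : ∀ z, 0 < M z) :
    ∀ t : ℕ, t < T →
      (logitMatrix M (fun h : Fin t → S => List.ofFn h)
        (fun f : (j : Fin (T - t + 1)) × (Fin (j : ℕ) → S) => List.ofFn f.2)).rank ≤ d := by
  intro t ht
  let X : Matrix (Fin t → S) (Fin d) ℝ :=
    Matrix.of fun h => tvState A x0 (listSeq (List.ofFn h)) t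
  let C : Matrix (Fin d) (((j : Fin (T - t + 1)) × (Fin (j : ℕ) → S)) × S) ℝ :=
    Matrix.of fun i p =>
      let N := B (t + p.1.1) * transitionMatrix A (listSeq (List.ofFn p.1.2)) t p.1.1
      if t + p.1.1 < T then N p.2 i - (1 / (Fintype.card S : ℝ)) * ∑ s', N s' i else 0
  have hXC : logitMatrix M (fun h : Fin t → S => List.ofFn h)
      (fun f : (j : Fin (T - t + 1)) × (Fin (j : ℕ) → S) => List.ofFn f.2) = X * C := by
    ext h p
    rw [Matrix.mul_apply]
    simp only [logitMatrix, Matrix.of_apply, X, C]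
    by_cases hp : t + (p.1.1 : ℕ) < T
    · rw [mcLogit_append hM (by simpa using hp)]
      simp only [List.length_ofFn, if_pos hp]
    · rw [mcLogit_of_length_ge M (by simpa using hp)]
      simp [hp]
  rw [hXC]
  exact (Matrix.rank_mul_le_left X C).trans (by simpa using X.rank_le_card_width)
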